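/- arXiv:1510.02808 — 3 statements merged into one kernel-verified Lean document; each statement's English description precedes it below -/
import Mathlib

section
/- Let n ≥ 2 and let {μ(t)}_{t=0}^∞ ⊂ Δ_n satisfy Assumption (M) with constant M, and let S = {(p,q) ∈ Δ_n × Δ_n : 1/M ≤ q_i/p_i ≤ M for all i}. Suppose the empirical measures ℙ_t = (1/t) Σ_{s=0}^{t−1} δ_{(μ(s), μ(s+1))} converge weakly to a Borel probability measure ℙ on S that is absolutely continuous with respect to Lebesgue measure. Then for every functionally generated portfolio π ∈ FG the asymptotic growth rate W(π) = lim_{t→∞} (1/t) log V_π(t) exists, and moreover the convergence is uniform: lim_{t→∞} sup_{π ∈ FG} | (1/t) log V_π(t) − W(π) | = 0. -/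
open MeasureTheory Filter Topology Finset
open scoped UniformConvergence ENNReal

noncomputable section

/-- The open unit simplex in `ℝⁿ`. -/
def oS (n : ℕ) : Set (Fin n → ℝ) := {p | (∀ i, 0 < p i) ∧ ∑ i, p i = 1}

/-- The closed unit simplex in `ℝⁿ`. -/
def cS (n : ℕ) : Set (Fin n → ℝ) := {p | (∀ i, 0 ≤ p i) ∧ ∑ i, p i = 1}

/-- Relative value of a (time-dependent) weight sequence `w` along market path `μ`. -/
def relV {n : ℕ} (μ w : ℕ → Fin n → ℝ) : ℕ → ℝ
  | 0 => 1
  | t + 1 => relV μ w t * ∑ i, w t i * (μ (t + 1) i / μ t i)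

/-- Relative value of a portfolio map. -/
def pV {n : ℕ} (μ : ℕ → ↥(oS n)) (π : ↥(oS n) → ↥(cS n)) : ℕ → ℝ :=
  relV (fun t => (μ t : Fin n → ℝ)) (fun t => (π (μ t) : Fin n → ℝ))

/-- A functionally generated portfolio map. -/
def IsFG {n : ℕ} (π : ↥(oS n) → ↥(cS n)) : Prop :=
  ∃ Φ : (Fin n → ℝ) → ℝ, (∀ p ∈ oS n, 0 < Φ p) ∧ ConcaveOn ℝ (oS n) Φ ∧
    ∀ p q : ↥(oS n),
      Φ (q : Fin n → ℝ) / Φ (p : Fin n → ℝ) ≤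
        ∑ i, (π p : Fin n → ℝ) i * ((q : Fin n → ℝ) i / (p : Fin n → ℝ) i)

/-- The compact set `S = {(p,q) ∈ Δₙ × Δₙ : 1/M ≤ qᵢ/pᵢ ≤ M ∀ i}`. -/
def Sset (n : ℕ) (M : ℝ) : Set ((Fin n → ℝ) × (Fin n → ℝ)) :=
  {pq | pq.1 ∈ oS n ∧ pq.2 ∈ oS n ∧ ∀ i, 1 / M ≤ pq.2 i / pq.1 i ∧ pq.2 i / pq.1 i ≤ M}

/-- The function `ℓ_π(p,q) = log(π(p)·(q/p))`, viewed as a function on `S`. -/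
def lS {n : ℕ} {M : ℝ} (π : ↥(oS n) → ↥(cS n)) (x : ↥(Sset n M)) : ℝ :=
  Real.log (∑ i, (π ⟨x.1.1, x.2.1⟩ : Fin n → ℝ) i * (x.1.2 i / x.1.1 i))

/-- The empirical measure `ℙ_t = (1/t) Σ_{s<t} δ_{(μ(s),μ(s+1))}` as a measure on `S`. -/
def empS {n : ℕ} {M : ℝ} (μ : ℕ → ↥(oS n))
    (hS : ∀ s : ℕ, ((μ s : Fin n → ℝ), (μ (s + 1) : Fin n → ℝ)) ∈ Sset n M) (t : ℕ) :
    Measure ↥(Sset n M) :=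
  (t : ℝ≥0∞)⁻¹ • ∑ s ∈ Finset.range t,
    Measure.dirac (⟨((μ s : Fin n → ℝ), (μ (s + 1) : Fin n → ℝ)), hS s⟩ : ↥(Sset n M))

theorem gc_abstract {X : Type*} [MetricSpace X] [SecondCountableTopology X] [MeasurableSpace X]
    [BorelSpace X] (P : Measure X) [IsProbabilityMeasure P] (U : Filter ℕ) 
    (F : ℕ → X → ℝ) (C : ℝ) (hC : ∀ k x, |F k x| ≤ C)
    (hae : ∀ᵐ x0 ∂P, ∃ L : ℝ, Tendsto (fun z : ℕ × X => F z.1 z.2) (U ×ˢ 𝓝 x0) (𝓝 L))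
    (ε : ℝ) (hε : 0 < ε) :
    ∃ f ψ : BoundedContinuousFunction X ℝ, (∀ x, 0 ≤ ψ x) ∧ ∫ x, ψ x ∂P < ε ∧
      ∀ᶠ k in U, ∀ x, |F k x - f x| ≤ ε + C * ψ x := by
  classical
  set G : Set X := {x0 | ∃ L : ℝ, Tendsto (fun z : ℕ × X => F z.1 z.2) (U ×ˢ 𝓝 x0) (𝓝 L)} with hG
  have key : ∀ x0 : G, ∃ L : ℝ, ∃ r : ℝ, 0 < r ∧ ∀ᶠ k in U, ∀ x, dist x x0.1 < r →
      |F k x - L| ≤ ε := by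
    rintro ⟨x0, L, hL⟩
    have h1 : ∀ᶠ z in U ×ˢ 𝓝 x0, |F z.1 z.2 - L| < ε := by
      have := (Metric.tendsto_nhds.1 hL) ε hε
      simpa [Real.dist_eq] using this
    obtain ⟨p, hp, q, hq, hpq⟩ := Filter.eventually_prod_iff.1 h1
    obtain ⟨r, hr, hrq⟩ := Metric.eventually_nhds_iff.1 hq
    refine ⟨L, r, hr, ?_⟩
    filter_upwards [hp] with k hk x hx
    exact (hpq hk (hrq hx)).le
  choose L r hr hev using key
  obtain ⟨T, hTc, hT⟩ := TopologicalSpace.isOpen_iUnion_countable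
    (fun x0 : G => Metric.ball x0.1 (r x0)) (fun _ => Metric.isOpen_ball)
  have hGne : G.Nonempty := hae.exists
  have hTne : T.Nonempty := by
    obtain ⟨x, hx⟩ := hGne
    have : x ∈ ⋃ i ∈ T, Metric.ball i.1 (r i) := by
      rw [hT]
      exact Set.mem_iUnion.2 ⟨⟨x, hx⟩, Metric.mem_ball_self (hr _)⟩
    obtain ⟨i, hi⟩ := Set.mem_iUnion.1 this
    obtain ⟨hi, _⟩ := Set.mem_iUnion.1 hi
    exact ⟨i, hi⟩
  obtain ⟨y, hy⟩ := hTc.exists_eq_range hTne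
  let φ : ℕ → X → ℝ := fun j x => max 0 (r (y j) - dist x (y j).1)
  have φ0 : ∀ j x, 0 ≤ φ j x := fun j x => le_max_left _ _
  have φc : ∀ j, Continuous (φ j) := fun j => by fun_prop
  let s : ℕ → X → ℝ := fun N x => ∑ j ∈ Finset.range N, φ j x
  have s0 : ∀ N x, 0 ≤ s N x := fun N x => Finset.sum_nonneg fun j _ => φ0 j x
  have sc : ∀ N, Continuous (s N) := fun N => by
    exact continuous_finsetSum _ fun j _ => φc j
  have d0 : ∀ (N : ℕ) x, 0 < 1 + (N : ℝ) * s N x := fun N x => by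
    have := mul_nonneg (Nat.cast_nonneg (α := ℝ) N) (s0 N x)
    linarith
  have d1 : ∀ (N : ℕ) x, 1 ≤ 1 + (N : ℝ) * s N x := fun N x => by
    have := mul_nonneg (Nat.cast_nonneg (α := ℝ) N) (s0 N x)
    linarith
  have ψb : ∀ (N : ℕ) x, ‖(1 : ℝ) / (1 + (N : ℝ) * s N x)‖ ≤ 1 := fun N x => by
    rw [Real.norm_of_nonneg (by have := d0 N x; positivity)]
    rw [div_le_one (d0 N x)]
    exact d1 N x
  have ψc : ∀ N : ℕ, Continuous (fun x => (1 : ℝ) / (1 + (N : ℝ) * s N x)) := fun N =>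
    continuous_const.div (by have := sc N; fun_prop) (fun x => (d0 N x).ne')
  have hlim : Tendsto (fun N : ℕ => ∫ x, (1 : ℝ) / (1 + (N : ℝ) * s N x) ∂P) atTop
      (𝓝 (∫ x, (0 : ℝ) ∂P)) := by
    refine tendsto_integral_of_dominated_convergence (fun _ => (1 : ℝ))
      (fun N => (ψc N).aestronglyMeasurable) (integrable_const _)
      (fun N => Eventually.of_forall (ψb N)) ?_
    filter_upwards [hae] with x hx
    have : x ∈ ⋃ i ∈ T, Metric.ball i.1 (r i) := by
      rw [hT]
      exact Set.mem_iUnion.2 ⟨⟨x, hx⟩, Metric.mem_ball_self (hr _)⟩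
    obtain ⟨i, hi⟩ := Set.mem_iUnion.1 this
    obtain ⟨hi, hxi⟩ := Set.mem_iUnion.1 hi
    rw [hy] at hi
    obtain ⟨j, rfl⟩ := hi
    have hpos : 0 < φ j x := by
      refine lt_max_of_lt_right ?_
      rw [Metric.mem_ball] at hxi
      linarith
    have h2 : Tendsto (fun N : ℕ => 1 + (N : ℝ) * s N x) atTop atTop := by
      refine tendsto_atTop_mono' (f₁ := fun N : ℕ => (N : ℝ) * φ j x) atTop ?_
        (tendsto_natCast_atTop_atTop.atTop_mul_const hpos)
      filter_upwards [eventually_gt_atTop j] with N hN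
      have h3 : φ j x ≤ s N x :=
        Finset.single_le_sum (f := fun j => φ j x) (fun j _ => φ0 j x) (Finset.mem_range.2 hN)
      have := mul_le_mul_of_nonneg_left h3 (Nat.cast_nonneg (α := ℝ) N)
      linarith
    have h4 := h2.inv_tendsto_atTop
    refine h4.congr fun N => ?_
    simp
  rw [integral_zero] at hlim
  obtain ⟨N, hN⟩ := (hlim.eventually (gt_mem_nhds hε)).exists
  let g : X → ℝ := fun x => (N : ℝ) * (∑ j ∈ Finset.range N, φ j x * L (y j)) / (1 + (N : ℝ) * s N x)
  have gc : Continuous g := by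
    refine Continuous.div ?_ (by have := sc N; fun_prop) (fun x => (d0 N x).ne')
    exact continuous_const.mul (continuous_finsetSum _ fun j _ => (φc j).mul continuous_const)
  have gb : ∀ x, ‖g x‖ ≤ ∑ j ∈ Finset.range N, |L (y j)| := by
    intro x
    rw [Real.norm_eq_abs, abs_div, abs_of_pos (d0 N x), div_le_iff₀ (d0 N x), abs_mul,
      abs_of_nonneg (Nat.cast_nonneg (α := ℝ) N)]
    have hB : 0 ≤ ∑ j ∈ Finset.range N, |L (y j)| := Finset.sum_nonneg fun _ _ => abs_nonneg _
    have h1 : |∑ j ∈ Finset.range N, φ j x * L (y j)| ≤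
        s N x * ∑ j ∈ Finset.range N, |L (y j)| := by
      refine (Finset.abs_sum_le_sum_abs _ _).trans ?_
      rw [Finset.sum_mul]
      refine Finset.sum_le_sum fun j hj => ?_
      rw [abs_mul, abs_of_nonneg (φ0 j x)]
      exact mul_le_mul_of_nonneg_left
        (Finset.single_le_sum (f := fun j => |L (y j)|) (fun _ _ => abs_nonneg _) hj) (φ0 j x)
    have h2 := mul_le_mul_of_nonneg_left h1 (Nat.cast_nonneg (α := ℝ) N)
    nlinarith
  refine ⟨BoundedContinuousFunction.ofNormedAddCommGroup g gc _ gb,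
    BoundedContinuousFunction.ofNormedAddCommGroup _ (ψc N) 1 (ψb N), ?_, hN, ?_⟩
  · intro x
    have := d0 N x
    simp only [BoundedContinuousFunction.coe_ofNormedAddCommGroup]
    positivity
  have hall : ∀ᶠ k in U, ∀ j ∈ Finset.range N, ∀ x, dist x (y j).1 < r (y j) →
      |F k x - L (y j)| ≤ ε := by
    rw [Filter.eventually_all_finset]
    exact fun j _ => hev (y j)
  filter_upwards [hall] with k hk x
  simp only [BoundedContinuousFunction.coe_ofNormedAddCommGroup]
  have e1 : F k x - g x = (F k x + (N : ℝ) * ∑ j ∈ Finset.range N, φ j x * (F k x - L (y j)))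
      / (1 + (N : ℝ) * s N x) := by
    have hs : ∑ j ∈ Finset.range N, φ j x * (F k x - L (y j)) =
        s N x * F k x - ∑ j ∈ Finset.range N, φ j x * L (y j) := by
      simp only [mul_sub, Finset.sum_sub_distrib, s, Finset.sum_mul]
    rw [hs]
    have := (d0 N x).ne'
    simp only [g]
    field_simp
    ring
  have e2 : |∑ j ∈ Finset.range N, φ j x * (F k x - L (y j))| ≤ s N x * ε := by
    refine (Finset.abs_sum_le_sum_abs _ _).trans ?_
    simp only [s]
    rw [Finset.sum_mul]
    refine Finset.sum_le_sum fun j hj => ?_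
    rw [abs_mul, abs_of_nonneg (φ0 j x)]
    by_cases hd : dist x (y j).1 < r (y j)
    · exact mul_le_mul_of_nonneg_left (hk j hj x hd) (φ0 j x)
    · have : φ j x = 0 := max_eq_left (by linarith)
      simp [this]
  rw [e1, abs_div, abs_of_pos (d0 N x), div_le_iff₀ (d0 N x)]
  have e3 : (ε + C * (1 / (1 + (N : ℝ) * s N x))) * (1 + (N : ℝ) * s N x)
      = ε * (1 + (N : ℝ) * s N x) + C := by
    have := (d0 N x).ne'
    field_simp
  rw [e3]
  refine (abs_add_le _ _).trans ?_
  rw [abs_mul, abs_of_nonneg (Nat.cast_nonneg (α := ℝ) N)]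
  have := mul_le_mul_of_nonneg_left e2 (Nat.cast_nonneg (α := ℝ) N)
  have := hC k x
  nlinarith

/-- coordinatewise logarithm -/
def lam {n : ℕ} (p : Fin n → ℝ) : Fin n → ℝ := fun i => Real.log (p i)

theorem sum_bounds {n : ℕ} (w : ↥(cS n)) (x : Fin n → ℝ) (a b : ℝ) (h : ∀ i, a ≤ x i ∧ x i ≤ b) :
    a ≤ ∑ i, (w : Fin n → ℝ) i * x i ∧ ∑ i, (w : Fin n → ℝ) i * x i ≤ b := by
  have h1 := w.2.2
  constructor
  · calc a = ∑ i, (w : Fin n → ℝ) i * a := by rw [← Finset.sum_mul, h1, one_mul]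
      _ ≤ _ := Finset.sum_le_sum fun i _ => mul_le_mul_of_nonneg_left (h i).1 (w.2.1 i)
  · calc _ ≤ ∑ i, (w : Fin n → ℝ) i * b :=
          Finset.sum_le_sum fun i _ => mul_le_mul_of_nonneg_left (h i).2 (w.2.1 i)
      _ = b := by rw [← Finset.sum_mul, h1, one_mul]

theorem fg_lip {n : ℕ} (π : ↥(oS n) → ↥(cS n)) (Φ : (Fin n → ℝ) → ℝ)
    (hpos : ∀ p ∈ oS n, 0 < Φ p)
    (hfg : ∀ p q : ↥(oS n),
      Φ (q : Fin n → ℝ) / Φ (p : Fin n → ℝ) ≤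
        ∑ i, (π p : Fin n → ℝ) i * ((q : Fin n → ℝ) i / (p : Fin n → ℝ) i))
    (p q : Fin n → ℝ) (hp : p ∈ oS n) (hq : q ∈ oS n) :
    |Real.log (Φ p) - Real.log (Φ q)| ≤ dist (lam p) (lam q) := by
  have one : ∀ p q : Fin n → ℝ, p ∈ oS n → q ∈ oS n →
      Real.log (Φ q) - Real.log (Φ p) ≤ dist (lam p) (lam q) := by
    intro p q hp hq
    rw [← Real.log_div (hpos q hq).ne' (hpos p hp).ne']
    rw [Real.log_le_iff_le_exp (div_pos (hpos q hq) (hpos p hp))]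
    refine (hfg ⟨p, hp⟩ ⟨q, hq⟩).trans ?_
    refine (sum_bounds (π ⟨p, hp⟩) (fun i => q i / p i) 0 _ fun i => ⟨?_, ?_⟩).2
    · exact (div_pos (hq.1 i) (hp.1 i)).le
    · rw [← Real.log_le_iff_le_exp (div_pos (hq.1 i) (hp.1 i)),
        Real.log_div (hq.1 i).ne' (hp.1 i).ne']
      have := dist_le_pi_dist (lam p) (lam q) i
      refine le_trans ?_ this
      rw [dist_comm]
      exact le_abs_self _
  rw [abs_le]
  have h1 := one p q hp hq
  have h2 := one q p hq hp
  rw [dist_comm] at h2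
  constructor <;> linarith

theorem fg_sand {n : ℕ} (π : ↥(oS n) → ↥(cS n)) (Φ : (Fin n → ℝ) → ℝ)
    (hfg : ∀ p q : ↥(oS n),
      Φ (q : Fin n → ℝ) / Φ (p : Fin n → ℝ) ≤
        ∑ i, (π p : Fin n → ℝ) i * ((q : Fin n → ℝ) i / (p : Fin n → ℝ) i))
    (p q : Fin n → ℝ) (hp : p ∈ oS n) (h : ℝ) (hph : p + h • (q - p) ∈ oS n) :
    Φ (p + h • (q - p)) / Φ p - 1 ≤ h * (∑ i, (π ⟨p, hp⟩ : Fin n → ℝ) i * (q i / p i) - 1) := by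
  have h1 := hfg ⟨p, hp⟩ ⟨_, hph⟩
  have h2 : ∑ i, (π ⟨p, hp⟩ : Fin n → ℝ) i * ((p + h • (q - p)) i / p i) =
      1 + h * (∑ i, (π ⟨p, hp⟩ : Fin n → ℝ) i * (q i / p i) - 1) := by
    have hs := (π ⟨p, hp⟩).2.2
    have e : ∀ i, (π ⟨p, hp⟩ : Fin n → ℝ) i * ((p + h • (q - p)) i / p i) =
        (1 - h) * (π ⟨p, hp⟩ : Fin n → ℝ) i + h * ((π ⟨p, hp⟩ : Fin n → ℝ) i * (q i / p i)) := by
      intro i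
      have := (hp.1 i).ne'
      simp only [Pi.add_apply, Pi.smul_apply, Pi.sub_apply, smul_eq_mul]
      field_simp
      ring
    simp only [e]
    rw [Finset.sum_add_distrib, ← Finset.mul_sum, ← Finset.mul_sum, hs]
    ring
  simp only at h1
  rw [h2] at h1
  linarith

theorem lam_tendsto {n : ℕ} {X : Type*} (l : Filter X) (g : X → Fin n → ℝ) (p : Fin n → ℝ)
    (hp : ∀ i, 0 < p i) (hg : Tendsto g l (𝓝 p)) : Tendsto (fun x => lam (g x)) l (𝓝 (lam p)) := by
  rw [tendsto_pi_nhds] at hg ⊢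
  intro i
  exact (hg i).log (hp i).ne'

theorem phi_tendsto {n : ℕ} {X : Type*} [TopologicalSpace X] (U : Filter ℕ)
    (Ψ : ℕ → (Fin n → ℝ) → ℝ) (ψ : (Fin n → ℝ) → ℝ)
    (hlip : ∀ k, ∀ p ∈ oS n, ∀ q ∈ oS n, |Ψ k p - Ψ k q| ≤ dist (lam p) (lam q))
    (hψ : ∀ p ∈ oS n, Tendsto (fun k => Ψ k p) U (𝓝 (ψ p)))
    (g : X → Fin n → ℝ) (x0 : X) (hg : ContinuousAt g x0) (h0 : g x0 ∈ oS n)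
    (hev : ∀ᶠ x in 𝓝 x0, g x ∈ oS n) :
    Tendsto (fun z : ℕ × X => Ψ z.1 (g z.2)) (U ×ˢ 𝓝 x0) (𝓝 (ψ (g x0))) := by
  have h1 : Tendsto (fun z : ℕ × X => Ψ z.1 (g x0)) (U ×ˢ 𝓝 x0) (𝓝 (ψ (g x0))) :=
    (hψ _ h0).comp tendsto_fst
  have h2 : Tendsto (fun z : ℕ × X => Ψ z.1 (g z.2) - Ψ z.1 (g x0)) (U ×ˢ 𝓝 x0) (𝓝 0) := by
    have h3 : Tendsto (fun x => dist (lam (g x)) (lam (g x0))) (𝓝 x0) (𝓝 0) :=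
      tendsto_iff_dist_tendsto_zero.1 (lam_tendsto _ g _ h0.1 hg)
    refine squeeze_zero_norm' ?_ (h3.comp (tendsto_snd (f := U)))
    filter_upwards [tendsto_snd.eventually hev] with z hz
    exact hlip z.1 _ hz _ h0
  simpa using h1.add h2

theorem line_mem {n : ℕ} {p q : Fin n → ℝ} (hp : p ∈ oS n) (hq : q ∈ oS n) (h : ℝ)
    (hpos : ∀ i, 0 < (p + h • (q - p)) i) : p + h • (q - p) ∈ oS n := by
  refine ⟨hpos, ?_⟩
  simp only [Pi.add_apply, Pi.smul_apply, Pi.sub_apply, smul_eq_mul]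
  rw [Finset.sum_add_distrib, ← Finset.mul_sum, Finset.sum_sub_distrib, hp.2, hq.2]
  ring

theorem line_ev {n : ℕ} {p q : Fin n → ℝ} (hp : p ∈ oS n) (hq : q ∈ oS n) :
    ∀ᶠ h : ℝ in 𝓝 0, p + h • (q - p) ∈ oS n := by
  have : ∀ᶠ h : ℝ in 𝓝 0, ∀ i, 0 < (p + h • (q - p)) i := by
    rw [eventually_all]
    intro i
    have hc : ContinuousAt (fun h : ℝ => (p + h • (q - p)) i) 0 := by
      simp only [Pi.add_apply, Pi.smul_apply, Pi.sub_apply, smul_eq_mul]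
      fun_prop
    exact hc.eventually (lt_mem_nhds (by simpa using hp.1 i))
  filter_upwards [this] with h hh using line_mem hp hq h hh

theorem good_point {n : ℕ} {M : ℝ} (hM : 0 < M) (U : Filter ℕ) [U.NeBot]
    (π : ℕ → ↥(oS n) → ↥(cS n)) (Φ : ℕ → (Fin n → ℝ) → ℝ)
    (hpos : ∀ k, ∀ p ∈ oS n, 0 < Φ k p)
    (hfg : ∀ k, ∀ p q : ↥(oS n),
      Φ k (q : Fin n → ℝ) / Φ k (p : Fin n → ℝ) ≤
        ∑ i, (π k p : Fin n → ℝ) i * ((q : Fin n → ℝ) i / (p : Fin n → ℝ) i))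
    (a : ℕ → ℝ) (ψ : (Fin n → ℝ) → ℝ)
    (hψ : ∀ p ∈ oS n, Tendsto (fun k => Real.log (Φ k p) - a k) U (𝓝 (ψ p)))
    (x0 : ↥(Sset n M))
    (hd : DifferentiableAt ℝ (fun h : ℝ => ψ (x0.1.1 + h • (x0.1.2 - x0.1.1))) 0) :
    ∃ L : ℝ, Tendsto (fun z : ℕ × ↥(Sset n M) => lS (π z.1) z.2) (U ×ˢ 𝓝 x0) (𝓝 L) := by
  set p0 := x0.1.1 with hp0
  set q0 := x0.1.2 with hq0
  have mp0 : p0 ∈ oS n := x0.2.1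
  have mq0 : q0 ∈ oS n := x0.2.2.1
  let r0 : ℝ → ℝ := fun h => Real.exp (ψ (p0 + h • (q0 - p0)) - ψ p0)
  have r00 : r0 0 = 1 := by simp [r0]
  have hd2 : DifferentiableAt ℝ r0 0 := (hd.sub_const _).exp
  set d := deriv r0 0 with hdd
  have hslope := hasDerivAt_iff_tendsto_slope_zero.1 hd2.hasDerivAt
  simp only [zero_add, r00, smul_eq_mul] at hslope
  let r : ℝ → ℕ × ↥(Sset n M) → ℝ := fun h z =>
    Φ z.1 (z.2.1.1 + h • (z.2.1.2 - z.2.1.1)) / Φ z.1 z.2.1.1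
  have hcont : ∀ h : ℝ, Continuous (fun x : ↥(Sset n M) => x.1.1 + h • (x.1.2 - x.1.1)) := by
    intro h; fun_prop
  have hmem : ∀ h : ℝ, p0 + h • (q0 - p0) ∈ oS n →
      ∀ᶠ x : ↥(Sset n M) in 𝓝 x0, x.1.1 + h • (x.1.2 - x.1.1) ∈ oS n := by
    intro h hh
    have : ∀ᶠ x : ↥(Sset n M) in 𝓝 x0, ∀ i, 0 < (x.1.1 + h • (x.1.2 - x.1.1)) i := by
      rw [eventually_all]
      intro i
      exact ((continuous_apply i).comp (hcont h)).continuousAt.eventually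
        (lt_mem_nhds (hh.1 i))
    filter_upwards [this] with x hx using line_mem x.2.1 x.2.2.1 h hx
  have hlip : ∀ k, ∀ p ∈ oS n, ∀ q ∈ oS n,
      |(Real.log (Φ k p) - a k) - (Real.log (Φ k q) - a k)| ≤ dist (lam p) (lam q) := by
    intro k p hp q hq
    rw [sub_sub_sub_cancel_right]
    exact fg_lip (π k) (Φ k) (hpos k) (hfg k) p q hp hq
  have hr : ∀ h : ℝ, p0 + h • (q0 - p0) ∈ oS n →
      Tendsto (r h) (U ×ˢ 𝓝 x0) (𝓝 (r0 h)) := by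
    intro h hh
    have t1 := phi_tendsto U (fun k p => Real.log (Φ k p) - a k) ψ hlip hψ
      (fun x : ↥(Sset n M) => x.1.1 + h • (x.1.2 - x.1.1)) x0 (hcont h).continuousAt hh (hmem h hh)
    have t2 := phi_tendsto U (fun k p => Real.log (Φ k p) - a k) ψ hlip hψ
      (fun x : ↥(Sset n M) => x.1.1) x0 (by fun_prop) mp0
      (Eventually.of_forall fun x => x.2.1)
    have t3 := (Real.continuous_exp.tendsto _).comp (t1.sub t2)
    refine Tendsto.congr' ?_ t3
    filter_upwards [tendsto_snd.eventually (hmem h hh)] with z hz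
    simp only [Function.comp, r]
    rw [sub_sub_sub_cancel_right, Real.exp_sub, Real.exp_log (hpos _ _ hz),
      Real.exp_log (hpos _ _ z.2.2.1)]
  let R : ℕ × ↥(Sset n M) → ℝ := fun z =>
    ∑ i, (π z.1 ⟨z.2.1.1, z.2.2.1⟩ : Fin n → ℝ) i * (z.2.1.2 i / z.2.1.1 i)
  have hR : Tendsto R (U ×ˢ 𝓝 x0) (𝓝 (1 + d)) := by
    rw [tendsto_order]
    constructor
    · intro b hb
      have hright : Tendsto (fun t : ℝ => t⁻¹ * (r0 t - 1)) (𝓝[>] 0) (𝓝 d) :=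
        hslope.mono_left (nhdsWithin_mono _ (fun t ht => ne_of_gt ht))
      have e1 := hright.eventually (lt_mem_nhds (show b - 1 < d by linarith))
      have e2 : ∀ᶠ t : ℝ in 𝓝[>] 0, p0 + t • (q0 - p0) ∈ oS n :=
        (line_ev mp0 mq0).filter_mono nhdsWithin_le_nhds
      obtain ⟨h, ⟨h1, h2⟩, h3⟩ := ((e1.and e2).and self_mem_nhdsWithin).exists
      have h3 : 0 < h := h3
      have t := ((hr h h2).sub_const 1).const_mul h⁻¹
      filter_upwards [t.eventually (lt_mem_nhds h1), tendsto_snd.eventually (hmem h h2)] with z hz hm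
      have := fg_sand (π z.1) (Φ z.1) (hfg z.1) z.2.1.1 z.2.1.2 z.2.2.1 h hm
      have h4 : h⁻¹ * (r h z - 1) ≤ R z - 1 := by
        rw [inv_mul_le_iff₀ h3]; exact this
      linarith
    · intro b hb
      have hleft : Tendsto (fun t : ℝ => t⁻¹ * (r0 t - 1)) (𝓝[<] 0) (𝓝 d) :=
        hslope.mono_left (nhdsWithin_mono _ (fun t ht => ne_of_lt ht))
      have e1 := hleft.eventually (gt_mem_nhds (show d < b - 1 by linarith))
      have e2 : ∀ᶠ t : ℝ in 𝓝[<] 0, p0 + t • (q0 - p0) ∈ oS n :=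
        (line_ev mp0 mq0).filter_mono nhdsWithin_le_nhds
      obtain ⟨h, ⟨h1, h2⟩, h3⟩ := ((e1.and e2).and self_mem_nhdsWithin).exists
      have h3 : h < 0 := h3
      have t := ((hr h h2).sub_const 1).const_mul h⁻¹
      filter_upwards [t.eventually (gt_mem_nhds h1), tendsto_snd.eventually (hmem h h2)] with z hz hm
      have := fg_sand (π z.1) (Φ z.1) (hfg z.1) z.2.1.1 z.2.1.2 z.2.2.1 h hm
      have h4 : R z - 1 ≤ h⁻¹ * (r h z - 1) := by
        have h5 := mul_le_mul_of_nonpos_left this (inv_lt_zero.2 h3).le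
        rw [inv_mul_cancel_left₀ h3.ne] at h5
        exact h5
      linarith
  have hge : 1 / M ≤ 1 + d := by
    refine ge_of_tendsto hR (Eventually.of_forall fun z => ?_)
    exact (sum_bounds _ (fun i => z.2.1.2 i / z.2.1.1 i) (1 / M) M z.2.2.2.2).1
  have h0 : 0 < 1 + d := lt_of_lt_of_le (by positivity) hge
  exact ⟨Real.log (1 + d), hR.log h0.ne'⟩

def ext0 {m : ℕ} (u : Fin m → ℝ) : Fin (m + 1) → ℝ := Fin.cons 0 u

def lse {m : ℕ} (u : Fin m → ℝ) : ℝ := Real.log (∑ j, Real.exp (ext0 u j))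

/-- softmax chart of the simplex -/
def smax {m : ℕ} (u : Fin m → ℝ) : Fin (m + 1) → ℝ := fun i => Real.exp (ext0 u i - lse u)

def kap {m : ℕ} (p : Fin (m + 1) → ℝ) : Fin m → ℝ := fun i => Real.log (p i.succ) - Real.log (p 0)

theorem ext0_lip {m : ℕ} (u v : Fin m → ℝ) (i : Fin (m + 1)) :
    |ext0 u i - ext0 v i| ≤ dist u v := by
  refine Fin.cases ?_ (fun j => ?_) i
  · simp [ext0]
  · simpa [ext0, Real.dist_eq] using dist_le_pi_dist u v j

theorem sumexp_pos {m : ℕ} (u : Fin m → ℝ) : 0 < ∑ j, Real.exp (ext0 u j) :=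
  Finset.sum_pos (fun _ _ => Real.exp_pos _) Finset.univ_nonempty

theorem lse_lip {m : ℕ} (u v : Fin m → ℝ) : |lse u - lse v| ≤ dist u v := by
  have one : ∀ u v : Fin m → ℝ, lse u ≤ dist u v + lse v := by
    intro u v
    rw [lse, Real.log_le_iff_le_exp (sumexp_pos u), Real.exp_add, lse, Real.exp_log (sumexp_pos v),
      Finset.mul_sum]
    refine Finset.sum_le_sum fun i _ => ?_
    rw [← Real.exp_add, Real.exp_le_exp]
    have := (abs_le.1 (ext0_lip u v i)).2
    linarith
  have h1 := one u v
  have h2 := one v u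
  rw [dist_comm] at h2
  rw [abs_le]
  constructor <;> linarith

theorem smax_mem {m : ℕ} (u : Fin m → ℝ) : smax u ∈ oS (m + 1) := by
  refine ⟨fun i => Real.exp_pos _, ?_⟩
  simp only [smax, Real.exp_sub, lse]
  rw [← Finset.sum_div, Real.exp_log (sumexp_pos u), div_self (sumexp_pos u).ne']

theorem lam_smax_lip {m : ℕ} (u v : Fin m → ℝ) :
    dist (lam (smax u)) (lam (smax v)) ≤ 2 * dist u v := by
  refine (dist_pi_le_iff (by positivity)).2 fun i => ?_
  simp only [lam, smax, Real.log_exp, Real.dist_eq]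
  have h1 := abs_le.1 (ext0_lip u v i)
  have h2 := abs_le.1 (lse_lip u v)
  rw [abs_le]
  constructor <;> linarith

theorem exp_lip {a b : ℝ} (ha : a ≤ 0) (hb : b ≤ 0) : |Real.exp a - Real.exp b| ≤ |a - b| := by
  have one : ∀ a b : ℝ, b ≤ 0 → Real.exp b - Real.exp a ≤ |a - b| := by
    intro a b hb
    have h1 := Real.add_one_le_exp (a - b)
    have h2 : Real.exp a = Real.exp b * Real.exp (a - b) := by rw [← Real.exp_add]; ring_nf
    have h3 := Real.exp_pos b
    have h4 : Real.exp b ≤ 1 := Real.exp_le_one_iff.2 hb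
    have h5 := neg_abs_le (a - b)
    have h6 := abs_nonneg (a - b)
    have h7 : Real.exp b * (a - b + 1) ≤ Real.exp a := by
      rw [h2]; exact mul_le_mul_of_nonneg_left h1 h3.le
    nlinarith
  have h1 := one a b hb
  have h2 := one b a ha
  rw [abs_sub_comm] at h2
  rw [abs_le]
  constructor <;> linarith

theorem smax_lip {m : ℕ} : LipschitzWith 2 (smax (m := m)) := by
  refine LipschitzWith.of_dist_le_mul fun u v => ?_
  have hle : ∀ (u : Fin m → ℝ) i, lam (smax u) i ≤ 0 := by
    intro u i
    refine Real.log_nonpos ((smax_mem u).1 i).le ?_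
    rw [← (smax_mem u).2]
    exact Finset.single_le_sum (f := smax u) (fun j _ => ((smax_mem u).1 j).le) (Finset.mem_univ i)
  refine (dist_pi_le_iff (by positivity)).2 fun i => ?_
  refine le_trans ?_ (lam_smax_lip u v)
  refine le_trans ?_ (dist_le_pi_dist _ _ i)
  have := exp_lip (hle u i) (hle v i)
  simpa [lam, Real.exp_log ((smax_mem u).1 i), Real.exp_log ((smax_mem v).1 i), Real.dist_eq]
    using this

theorem smax_kap {m : ℕ} (p : Fin (m + 1) → ℝ) (hp : p ∈ oS (m + 1)) : smax (kap p) = p := by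
  have h0 := hp.1 0
  have he : ∀ i, Real.exp (ext0 (kap p) i) = p i / p 0 := by
    intro i
    refine Fin.cases ?_ (fun j => ?_) i
    · simp [ext0, h0.ne']
    · simp [ext0, kap, Real.exp_sub, Real.exp_log h0, Real.exp_log (hp.1 j.succ)]
  have hl : Real.exp (lse (kap p)) = 1 / p 0 := by
    rw [lse, Real.exp_log (sumexp_pos _)]
    simp only [he]
    rw [← Finset.sum_div, hp.2]
  ext i
  rw [smax, Real.exp_sub, he, hl]
  field_simp

theorem ae_diff {m : ℕ} {M : ℝ} (P : Measure ↥(Sset (m + 1) M))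
    (habs : P.map Subtype.val ≪ Measure.hausdorffMeasure (2 * ((m + 1 : ℕ) : ℝ) - 2))
    (ψ : (Fin (m + 1) → ℝ) → ℝ)
    (hlip : ∀ p ∈ oS (m + 1), ∀ q ∈ oS (m + 1), |ψ p - ψ q| ≤ dist (lam p) (lam q)) :
    ∀ᵐ x ∂P, DifferentiableAt ℝ (fun h : ℝ => ψ (x.1.1 + h • (x.1.2 - x.1.1))) 0 := by
  have hL : LipschitzWith 2 (fun u : Fin m → ℝ => ψ (smax u)) := by
    refine LipschitzWith.of_dist_le_mul fun u v => ?_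
    exact (hlip _ (smax_mem u) _ (smax_mem v)).trans (lam_smax_lip u v)
  have hae : ∀ᵐ u : Fin m → ℝ, DifferentiableAt ℝ (fun u : Fin m → ℝ => ψ (smax u)) u :=
    hL.ae_differentiableAt
  let N : Set (Fin m → ℝ) := {u | ¬ DifferentiableAt ℝ (fun u : Fin m → ℝ => ψ (smax u)) u}
  have hN : volume N = 0 := hae
  let Z : Set (Fin m ⊕ Fin m → ℝ) := {z | (fun i => z (Sum.inl i)) ∈ N}
  have hZ : volume Z = 0 := by
    have h1 := (volume_measurePreserving_sumPiEquivProdPi (fun _ : Fin m ⊕ Fin m => ℝ))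
    have h2 : (volume : Measure ((Fin m → ℝ) × (Fin m → ℝ))) (N ×ˢ Set.univ) = 0 := by
      rw [Measure.volume_eq_prod, Measure.prod_prod, hN, zero_mul]
    have h3 := h1.quasiMeasurePreserving.preimage_null h2
    refine measure_mono_null (fun z hz => ?_) h3
    exact ⟨hz, Set.mem_univ _⟩
  let G : (Fin m ⊕ Fin m → ℝ) → (Fin (m + 1) → ℝ) × (Fin (m + 1) → ℝ) :=
    fun z => (smax fun i => z (Sum.inl i), smax fun i => z (Sum.inr i))
  have hG : LipschitzWith 2 G := by
    refine LipschitzWith.of_dist_le_mul fun z w => ?_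
    rw [Prod.dist_eq]
    refine max_le ?_ ?_
    · refine (smax_lip.dist_le_mul _ _).trans ?_
      refine mul_le_mul_of_nonneg_left ?_ (by positivity)
      exact (dist_pi_le_iff dist_nonneg).2 fun i => dist_le_pi_dist z w _
    · refine (smax_lip.dist_le_mul _ _).trans ?_
      refine mul_le_mul_of_nonneg_left ?_ (by positivity)
      exact (dist_pi_le_iff dist_nonneg).2 fun i => dist_le_pi_dist z w _
  have hdim : (2 * ((m + 1 : ℕ) : ℝ) - 2) = (Fintype.card (Fin m ⊕ Fin m) : ℝ) := by
    simp; ring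
  have hH : Measure.hausdorffMeasure (2 * ((m + 1 : ℕ) : ℝ) - 2) (G '' Z) = 0 := by
    rw [hdim]
    have h1 := hG.hausdorffMeasure_image_le (d := (Fintype.card (Fin m ⊕ Fin m) : ℝ))
      (by positivity) Z
    rw [hausdorffMeasure_pi_real, hZ, mul_zero] at h1
    exact le_antisymm h1 bot_le
  have hmap : ∀ᵐ y ∂(P.map Subtype.val), y ∉ G '' Z := by
    have := habs hH
    exact measure_eq_zero_iff_ae_notMem.1 this
  have hP := ae_of_ae_map (measurable_subtype_coe.aemeasurable) hmap
  filter_upwards [hP] with x hx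
  set p := x.1.1 with hp
  set q := x.1.2 with hq
  have mp : p ∈ oS (m + 1) := x.2.1
  have mq : q ∈ oS (m + 1) := x.2.2.1
  have hnot : kap p ∉ N := by
    intro hk
    refine hx ⟨Sum.elim (kap p) (kap q), ?_, ?_⟩
    · simpa [Z] using hk
    · simp only [G, Sum.elim_inl, Sum.elim_inr]
      exact Prod.ext (smax_kap p mp) (smax_kap q mq)
  have hdiff : DifferentiableAt ℝ (fun u : Fin m → ℝ => ψ (smax u)) (kap p) := not_not.1 hnot
  have hk : DifferentiableAt ℝ (fun h : ℝ => kap (p + h • (q - p))) 0 := by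
    rw [differentiableAt_pi]
    intro i
    simp only [kap, Pi.add_apply, Pi.smul_apply, Pi.sub_apply, smul_eq_mul]
    refine DifferentiableAt.sub (DifferentiableAt.log (by fun_prop) ?_)
      (DifferentiableAt.log (by fun_prop) ?_)
    · simpa using (mp.1 _).ne'
    · simpa using (mp.1 _).ne'
  have hcomp : DifferentiableAt ℝ (fun h : ℝ => ψ (smax (kap (p + h • (q - p))))) 0 := by
    refine DifferentiableAt.comp (g := fun u : Fin m → ℝ => ψ (smax u)) (0 : ℝ) ?_ hk
    simpa using hdiff
  refine hcomp.congr_of_eventuallyEq ?_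
  filter_upwards [line_ev mp mq] with h hh
  rw [smax_kap _ hh]

theorem lS_bound {n : ℕ} {M : ℝ} (hM : 0 < M) (π : ↥(oS n) → ↥(cS n)) (x : ↥(Sset n M)) :
    |lS π x| ≤ Real.log M := by
  have h := sum_bounds (π ⟨x.1.1, x.2.1⟩) (fun i => x.1.2 i / x.1.1 i) (1 / M) M x.2.2.2
  have h0 : 0 < 1 / M := by positivity
  rw [abs_le]
  constructor
  · have := Real.log_le_log h0 h.1
    have e : Real.log (1 / M) = -Real.log M := by rw [one_div, Real.log_inv]
    exact e ▸ this
  · exact Real.log_le_log (h0.trans_le h.1) h.2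

theorem log_pV {n : ℕ} {M : ℝ} (hM : 0 < M) (μ : ℕ → ↥(oS n))
    (hS : ∀ s : ℕ, ((μ s : Fin n → ℝ), (μ (s + 1) : Fin n → ℝ)) ∈ Sset n M)
    (π : ↥(oS n) → ↥(cS n)) (t : ℕ) :
    0 < pV μ π t ∧ Real.log (pV μ π t) = ∑ s ∈ Finset.range t,
      lS π (⟨((μ s : Fin n → ℝ), (μ (s + 1) : Fin n → ℝ)), hS s⟩ : ↥(Sset n M)) := by
  induction t with
  | zero => simp [pV, relV]
  | succ t ih =>
    have h := (sum_bounds (π (μ t)) (fun i => (μ (t + 1) : Fin n → ℝ) i / (μ t : Fin n → ℝ) i)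
      (1 / M) M (hS t).2.2).1
    have h0 : 0 < 1 / M := by positivity
    have h1 := h0.trans_le h
    have e : pV μ π (t + 1) = pV μ π t *
        ∑ i, (π (μ t) : Fin n → ℝ) i * ((μ (t + 1) : Fin n → ℝ) i / (μ t : Fin n → ℝ) i) := rfl
    rw [e]
    refine ⟨mul_pos ih.1 h1, ?_⟩
    rw [Real.log_mul ih.1.ne' h1.ne', ih.2, Finset.sum_range_succ]
    rfl

theorem key_bracket {m : ℕ} {M : ℝ} (hM : 0 < M) (P : Measure ↥(Sset (m + 1) M))
    [IsProbabilityMeasure P]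
    (habs : P.map Subtype.val ≪ Measure.hausdorffMeasure (2 * ((m + 1 : ℕ) : ℝ) - 2))
    (U : Ultrafilter ℕ) (π : ℕ → ↥(oS (m + 1)) → ↥(cS (m + 1))) (hπ : ∀ k, IsFG (π k))
    (ε : ℝ) (hε : 0 < ε) :
    ∃ f ψ : BoundedContinuousFunction ↥(Sset (m + 1) M) ℝ, (∀ x, 0 ≤ ψ x) ∧ ∫ x, ψ x ∂P < ε ∧
      ∀ᶠ k in (U : Filter ℕ), ∀ x, |lS (π k) x - f x| ≤ ε + Real.log M * ψ x := by
  choose Φ hpos hconc hfg using hπ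
  let c : Fin (m + 1) → ℝ := smax 0
  have hc : c ∈ oS (m + 1) := smax_mem 0
  let a : ℕ → ℝ := fun k => Real.log (Φ k c)
  have hex : ∀ p : Fin (m + 1) → ℝ, ∃ y : ℝ, p ∈ oS (m + 1) →
      Tendsto (fun k => Real.log (Φ k p) - a k) U (𝓝 y) := by
    intro p
    by_cases hp : p ∈ oS (m + 1)
    · have hK : IsCompact (Set.Icc (-dist (lam p) (lam c)) (dist (lam p) (lam c))) := isCompact_Icc
      obtain ⟨y, -, hy⟩ := hK.ultrafilter_le_nhds' (U.map fun k => Real.log (Φ k p) - a k) (by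
        rw [Ultrafilter.mem_map]
        refine Filter.univ_mem' fun k => ?_
        exact abs_le.1 (fg_lip (π k) (Φ k) (hpos k) (hfg k) p c hp hc))
      exact ⟨y, fun _ => hy⟩
    · exact ⟨0, fun h => absurd h hp⟩
  choose ψ hψ using hex
  have hlip : ∀ p ∈ oS (m + 1), ∀ q ∈ oS (m + 1), |ψ p - ψ q| ≤ dist (lam p) (lam q) := by
    intro p hp q hq
    refine le_of_tendsto ((hψ p hp).sub (hψ q hq)).abs (Eventually.of_forall fun k => ?_)
    rw [sub_sub_sub_cancel_right]
    exact fg_lip (π k) (Φ k) (hpos k) (hfg k) p q hp hq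
  refine gc_abstract P U (fun k => lS (π k)) (Real.log M) (fun k x => lS_bound hM _ x) ?_ ε hε
  filter_upwards [ae_diff P habs ψ hlip] with x hx
  exact good_point hM U π Φ hpos hfg a ψ hψ x hx

theorem unif_cauchy {m : ℕ} {M : ℝ} (hM : 0 < M) (P : Measure ↥(Sset (m + 1) M))
    [IsProbabilityMeasure P]
    (habs : P.map Subtype.val ≪ Measure.hausdorffMeasure (2 * ((m + 1 : ℕ) : ℝ) - 2))
    (x : ℕ → ↥(Sset (m + 1) M))
    (hweak : ∀ f : BoundedContinuousFunction ↥(Sset (m + 1) M) ℝ,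
      Tendsto (fun t : ℕ => (∑ s ∈ Finset.range t, f (x s)) / t) atTop (𝓝 (∫ x, f x ∂P)))
    (ε : ℝ) (hε : 0 < ε) :
    ∃ T : ℕ, ∀ t ≥ T, ∀ s ≥ T, ∀ π : ↥(oS (m + 1)) → ↥(cS (m + 1)), IsFG π →
      |(∑ j ∈ Finset.range t, lS π (x j)) / t - (∑ j ∈ Finset.range s, lS π (x j)) / s| ≤ ε := by
  by_contra hcon
  push Not at hcon
  choose t ht s hs π hπ hlt using hcon
  let U : Ultrafilter ℕ := Ultrafilter.of atTop
  have hU : (U : Filter ℕ) ≤ atTop := Ultrafilter.of_le atTop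
  have hM0 : 0 ≤ Real.log M := (abs_nonneg _).trans (lS_bound hM (π 0) (x 0))
  set C := Real.log M with hC
  let δ := ε / (4 * (C + 1) + 2)
  have hδ : 0 < δ := by positivity
  obtain ⟨f, ψ, hψ0, hψ1, hev⟩ := key_bracket hM P habs U π hπ δ hδ
  have havg : ∀ k, (∀ y, |lS (π k) y - f y| ≤ δ + C * ψ y) → ∀ T : ℕ, 0 < T →
      |(∑ j ∈ Finset.range T, lS (π k) (x j)) / T - (∑ j ∈ Finset.range T, f (x j)) / T| ≤
        δ + C * ((∑ j ∈ Finset.range T, ψ (x j)) / T) := by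
    intro k hk T hT
    have hT : (0 : ℝ) < T := by exact_mod_cast hT
    rw [← sub_div, ← Finset.sum_sub_distrib, abs_div, abs_of_pos hT, div_le_iff₀ hT]
    refine (Finset.abs_sum_le_sum_abs _ _).trans ?_
    refine (Finset.sum_le_sum fun j _ => hk (x j)).trans ?_
    rw [Finset.sum_add_distrib, ← Finset.mul_sum]
    simp only [Finset.sum_const, Finset.card_range, nsmul_eq_mul]
    field_simp
    exact le_refl _
  have htt : Tendsto t atTop atTop := tendsto_atTop_mono ht tendsto_id
  have hss : Tendsto s atTop atTop := tendsto_atTop_mono hs tendsto_id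
  have hψe : ∀ᶠ T : ℕ in atTop, (∑ j ∈ Finset.range T, ψ (x j)) / T < δ :=
    (hweak ψ).eventually (gt_mem_nhds hψ1)
  have hfe : ∀ᶠ T : ℕ in atTop, |(∑ j ∈ Finset.range T, f (x j)) / T - ∫ x, f x ∂P| < δ / 2 := by
    have := (Metric.tendsto_nhds.1 (hweak f)) (δ / 2) (by positivity)
    simpa [Real.dist_eq] using this
  have hall : ∀ᶠ T : ℕ in atTop, 0 < T ∧ (∑ j ∈ Finset.range T, ψ (x j)) / T < δ ∧
      |(∑ j ∈ Finset.range T, f (x j)) / T - ∫ x, f x ∂P| < δ / 2 := by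
    filter_upwards [eventually_gt_atTop 0, hψe, hfe] with T h1 h2 h3 using ⟨h1, h2, h3⟩
  obtain ⟨k, hk, ⟨a1, a2, a3⟩, ⟨b1, b2, b3⟩⟩ :=
    (hev.and (((htt.eventually hall).filter_mono hU).and
      ((hss.eventually hall).filter_mono hU))).exists
  have u1 := havg k hk (t k) a1
  have u2 := havg k hk (s k) b1
  have v1 := mul_le_mul_of_nonneg_left a2.le hM0
  have v2 := mul_le_mul_of_nonneg_left b2.le hM0
  have w := hlt k
  have hδε : δ * (4 * (C + 1) + 2) = ε := by
    simp only [δ]; field_simp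
  have hδC : 0 ≤ C * δ := by positivity
  rw [abs_le] at u1 u2
  rw [abs_lt] at a3 b3
  refine absurd w (not_lt.2 ?_)
  rw [abs_le]
  constructor <;> nlinarith

/-- Theorem 1.3(i), Glivenko–Cantelli property: under weak convergence of the
empirical measures to an absolutely continuous probability measure on `S`, the asymptotic
growth rate `W(π)` exists for every `π ∈ FG` and `(1/t) log V_π(t) → W(π)` uniformly on `FG`. -/
theorem stmt1 {n : ℕ} (hn : 2 ≤ n) (M : ℝ) (hM : 0 < M)
    (μ : ℕ → ↥(oS n))
    (hS : ∀ s : ℕ, ((μ s : Fin n → ℝ), (μ (s + 1) : Fin n → ℝ)) ∈ Sset n M)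
    (P : Measure ↥(Sset n M)) [IsProbabilityMeasure P]
    (habs : P.map Subtype.val ≪ Measure.hausdorffMeasure (2 * (n : ℝ) - 2))
    (hweak : ∀ f : BoundedContinuousFunction ↥(Sset n M) ℝ,
      Tendsto (fun t : ℕ =>
          (∑ s ∈ Finset.range t,
            f ⟨((μ s : Fin n → ℝ), (μ (s + 1) : Fin n → ℝ)), hS s⟩) / t)
        atTop (𝓝 (∫ x, f x ∂P))) :
    ∃ W : (↥(oS n) → ↥(cS n)) → ℝ,
      (∀ π : ↥(oS n) → ↥(cS n), IsFG π →
        Tendsto (fun t : ℕ => Real.log (pV μ π t) / t) atTop (𝓝 (W π))) ∧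
      Tendsto (fun t : ℕ =>
          ⨆ π : {π : ↥(oS n) → ↥(cS n) // IsFG π}, |Real.log (pV μ π.1 t) / t - W π.1|)
        atTop (𝓝 0) := by
  obtain ⟨m, rfl⟩ : ∃ m, n = m + 1 := ⟨n - 1, by omega⟩
  have hcau := unif_cauchy hM P habs _ hweak
  let A : (↥(oS (m + 1)) → ↥(cS (m + 1))) → ℕ → ℝ := fun π t => Real.log (pV μ π t) / t
  have hA : ∀ ε > 0, ∃ T : ℕ, ∀ t ≥ T, ∀ s ≥ T, ∀ π : ↥(oS (m + 1)) → ↥(cS (m + 1)), IsFG π →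
      |A π t - A π s| ≤ ε := by
    intro ε hε
    obtain ⟨T, hT⟩ := hcau ε hε
    refine ⟨T, fun t ht s hs π hπ => ?_⟩
    simp only [A]
    rw [(log_pV hM μ hS π t).2, (log_pV hM μ hS π s).2]
    exact hT t ht s hs π hπ
  have hlim : ∀ π : ↥(oS (m + 1)) → ↥(cS (m + 1)), ∃ w : ℝ, IsFG π →
      Tendsto (A π) atTop (𝓝 w) := by
    intro π
    by_cases hπ : IsFG π
    · have hc : CauchySeq (A π) := by
        rw [Metric.cauchySeq_iff]
        intro ε hε
        obtain ⟨T, hT⟩ := hA (ε / 2) (by positivity)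
        refine ⟨T, fun t ht s hs => ?_⟩
        rw [Real.dist_eq]
        have := hT t ht s hs π hπ
        linarith
      obtain ⟨w, hw⟩ := cauchySeq_tendsto_of_complete hc
      exact ⟨w, fun _ => hw⟩
    · exact ⟨0, fun h => absurd h hπ⟩
  choose W hW using hlim
  refine ⟨W, hW, ?_⟩
  rw [Metric.tendsto_atTop]
  intro ε hε
  obtain ⟨T, hT⟩ := hA (ε / 2) (by positivity)
  refine ⟨T, fun t ht => ?_⟩
  have h1 : (⨆ π : {π : ↥(oS (m + 1)) → ↥(cS (m + 1)) // IsFG π},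
      |Real.log (pV μ π.1 t) / t - W π.1|) ≤ ε / 2 := by
    refine Real.iSup_le (fun π => ?_) (by positivity)
    refine le_of_tendsto ((tendsto_const_nhds (x := A π.1 t)).sub (hW π.1 π.2)).abs ?_
    filter_upwards [eventually_ge_atTop T] with s hs using hT t ht s hs π.1 π.2
  have h0 : 0 ≤ (⨆ π : {π : ↥(oS (m + 1)) → ↥(cS (m + 1)) // IsFG π},
      |Real.log (pV μ π.1 t) / t - W π.1|) := Real.iSup_nonneg fun _ => abs_nonneg _
  rw [Real.dist_eq, sub_zero, abs_of_nonneg h0]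
  linarith
end
end

section
/- Let n = 2, E = {p ∈ Δ_2 : p_1, p_2 rational}, Θ = (Δ̄_2)^E with the topology of pointwise convergence, and let ν_0 be the infinite product over E of the uniform distribution on Δ̄_2. For a rational δ > 0, let the market weight path be μ(0) = (1/2, 1/2), μ(t+1) = ( μ_1(t)/(1 + δ μ_2(t)), (1+δ)μ_2(t)/(1 + δ μ_2(t)) ). Then the wealth distributions {ν_t}_{t=0}^∞ satisfy the large deviation principle on Θ with the trivial rate function I(π) ≡ 0. -/
open scoped Classical

open MeasureTheory Filter Topology Finset
open scoped ENNReal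

noncomputable section

/-- Assumption (M): relative returns bounded between `1/M` and `M`. -/
def AssumptionM {n : ℕ} (M : ℝ) (μ : ℕ → ↥(oS n)) : Prop :=
  ∀ t i, 1 / M ≤ (μ (t + 1) : Fin n → ℝ) i / (μ t : Fin n → ℝ) i ∧
    (μ (t + 1) : Fin n → ℝ) i / (μ t : Fin n → ℝ) i ≤ M

/-- The rational points of the open simplex `Δ₂`. -/
def Eq2 : Set ↥(oS 2) := {p | ∀ i, ∃ r : ℚ, (p : Fin 2 → ℝ) i = (r : ℝ)}

/-- The parametrization `x ↦ (x, 1−x)` of the closed simplex `Δ̄₂` by `[0,1]`. -/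
def toSimplex2 (x : ℝ) : ↥(cS 2) :=
  if h : x ∈ Set.Icc (0 : ℝ) 1 then
    ⟨fun i => if i = 0 then x else 1 - x, by
      refine ⟨fun i => ?_, ?_⟩
      · by_cases hi : i = 0
        · simpa [hi] using h.1
        · simp only [hi, if_false]
          linarith [h.2]
      · simp [Fin.sum_univ_two]⟩
  else
    ⟨fun i => if i = 0 then 1 else 0, by
      refine ⟨fun i => ?_, ?_⟩
      · by_cases hi : i = 0 <;> simp [hi]
      · simp [Fin.sum_univ_two]⟩

/-- The uniform distribution on the closed simplex `Δ̄₂`. -/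
def unif2 : Measure ↥(cS 2) := Measure.map toSimplex2 (volume.restrict (Set.Icc 0 1))

/-- Relative value of a portfolio map defined on the rational points of `Δ₂`. -/
def pVQ (μ : ℕ → ↥(oS 2)) (hr : ∀ t, μ t ∈ Eq2) (π : ↥Eq2 → ↥(cS 2)) : ℕ → ℝ :=
  relV (fun t => (μ t : Fin 2 → ℝ)) (fun t => (π ⟨μ t, hr t⟩ : Fin 2 → ℝ))


/-- Normalized wealth distribution `ν_t(B) = (∫_B V dν₀)/(∫ V dν₀)`. -/
def wd {T : Type*} [MeasurableSpace T] (ν0 : Measure T) (V : T → ℝ) : Measure T :=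
  (ν0.withDensity (fun x => ENNReal.ofReal (V x)) Set.univ)⁻¹ •
    ν0.withDensity fun x => ENNReal.ofReal (V x)

/-- Abstract lower bound: fixing finitely many coordinates costs at most a constant factor. -/
lemma key_bound {ι X : Type*} [MeasurableSpace X] (P : Measure X) [IsProbabilityMeasure P]
    (ν : Measure (ι → X)) (hν : ν = Measure.infinitePi (fun _ : ι => P))
    (s : Finset ι) (B : ι → Set X) (hB : ∀ p ∈ s, MeasurableSet (B p))
    (pt : ℕ → ι) (hpt : Function.Injective pt) (g : ℕ → X → ℝ≥0∞) (hg : ∀ u, Measurable (g u))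
    (b : ℝ≥0∞) (hb1 : 1 ≤ b) (hbt : b ≠ ⊤) (hlo : ∀ u x, b⁻¹ ≤ g u x) (hhi : ∀ u x, g u x ≤ b)
    (t : ℕ) :
    (b ^ s.card)⁻¹ * ((b⁻¹) ^ s.card * ν (Set.pi s B)) ≤
      (∫⁻ π, ∏ u ∈ range t, g u (π (pt u)) ∂ν)⁻¹ *
        ∫⁻ π in Set.pi s B, ∏ u ∈ range t, g u (π (pt u)) ∂ν := by
  have hprob : IsProbabilityMeasure ν := by rw [hν]; infer_instance
  have hb0 : b ≠ 0 := (lt_of_lt_of_le one_pos hb1).ne'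
  set C := Set.pi (s : Set ι) B with hC
  have hCm : MeasurableSet C := MeasurableSet.pi s.countable_toSet (fun i hi => hB i hi)
  let U := (range t).filter (fun u => pt u ∈ s)
  let U' := (range t).filter (fun u => ¬ pt u ∈ s)
  have hUc : U.card ≤ s.card :=
    Finset.card_le_card_of_injOn pt (fun u hu => (Finset.mem_filter.1 hu).2) hpt.injOn
  let W : (ι → X) → ℝ≥0∞ := fun π => ∏ u ∈ U', g u (π (pt u))
  have hWm : Measurable W := by
    apply Finset.measurable_prod
    intro u _
    exact (hg u).comp (measurable_pi_apply _)
  have hsplit : ∀ π : ι → X, ∏ u ∈ range t, g u (π (pt u)) = (∏ u ∈ U, g u (π (pt u))) * W π :=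
    fun π => (Finset.prod_filter_mul_prod_filter_not _ _ _).symm
  have hUhi : ∀ π : ι → X, ∏ u ∈ U, g u (π (pt u)) ≤ b ^ s.card := fun π =>
    (Finset.prod_le_pow_card _ _ _ (fun u _ => hhi u _)).trans (pow_le_pow_right₀ hb1 hUc)
  have hUlo : ∀ π : ι → X, (b⁻¹) ^ s.card ≤ ∏ u ∈ U, g u (π (pt u)) := fun π => by
    refine (pow_le_pow_right_of_le_one' (ENNReal.inv_le_one.2 hb1) hUc).trans ?_
    rw [← Finset.prod_const]
    exact Finset.prod_le_prod' (fun u _ => hlo u _)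
  -- independence
  have hind : ∫⁻ π in C, W π ∂ν = ν C * ∫⁻ π, W π ∂ν := by
    have h1 : ProbabilityTheory.iIndepFun (fun (i : ι) (ω : ι → X) => ω i) ν := by
      rw [hν]
      exact ProbabilityTheory.iIndepFun_infinitePi (X := fun _ x => x) (fun _ => measurable_id)
    have hd : Disjoint s (U'.image pt) := by
      rw [Finset.disjoint_right]
      intro p hp
      obtain ⟨u, hu, rfl⟩ := Finset.mem_image.1 hp
      exact (Finset.mem_filter.1 hu).2
    have h2 := h1.indepFun_finset s (U'.image pt) hd (fun i => measurable_pi_apply i)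
    let f1 : (s → X) → ℝ≥0∞ := Set.indicator (Set.pi Set.univ (fun i : s => B i)) 1
    have hf1 : Measurable f1 :=
      measurable_one.indicator (MeasurableSet.pi Set.countable_univ (fun i _ => hB i i.2))
    let f2 : (↥(U'.image pt) → X) → ℝ≥0∞ :=
      fun x => ∏ u ∈ U'.attach, g u (x ⟨pt u, Finset.mem_image_of_mem _ u.2⟩)
    have hf2 : Measurable f2 := by
      apply Finset.measurable_prod
      intro u _
      exact (hg u).comp (measurable_pi_apply _)
    have h3 := h2.comp hf1 hf2
    have e1 : (f1 ∘ fun (a : ι → X) (i : s) => a i) = C.indicator 1 := by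
      ext a
      simp only [f1, Function.comp, Set.indicator_apply, hC]
      congr 1
      simp [Set.mem_pi]
    have e2 : (f2 ∘ fun (a : ι → X) (i : ↥(U'.image pt)) => a i) = W := by
      ext a
      simp only [f2, Function.comp, W]
      exact Finset.prod_attach U' (fun u => g u (a (pt u)))
    rw [e1, e2] at h3
    have h4 := ProbabilityTheory.lintegral_mul_eq_lintegral_mul_lintegral_of_indepFun
      (measurable_one.indicator hCm) hWm h3
    rw [lintegral_indicator_one hCm] at h4
    rw [← h4, ← lintegral_indicator hCm]
    congr 1
    ext a
    by_cases ha : a ∈ C <;> simp [ha]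
  set Q := ∫⁻ π, W π ∂ν with hQ
  have hQ0 : Q ≠ 0 := by
    have : (b⁻¹) ^ U'.card ≤ Q := by
      calc (b⁻¹) ^ U'.card = ∫⁻ _, (b⁻¹) ^ U'.card ∂ν := by simp
        _ ≤ Q := lintegral_mono (fun π => by
          rw [← Finset.prod_const]
          exact Finset.prod_le_prod' (fun u _ => hlo u _))
    refine ne_of_gt (lt_of_lt_of_le ?_ this)
    exact pos_iff_ne_zero.2 (pow_ne_zero _ (ENNReal.inv_ne_zero.2 hbt))
  have hQt : Q ≠ ⊤ := by
    have : Q ≤ b ^ U'.card := by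
      calc Q ≤ ∫⁻ _, b ^ U'.card ∂ν := lintegral_mono (fun π =>
            Finset.prod_le_pow_card _ _ _ (fun u _ => hhi u _))
        _ = _ := by simp
    exact ne_top_of_le_ne_top (ENNReal.pow_ne_top hbt) this
  have hD : ∫⁻ π, ∏ u ∈ range t, g u (π (pt u)) ∂ν ≤ b ^ s.card * Q := by
    rw [hQ, ← lintegral_const_mul _ hWm]
    refine lintegral_mono (fun π => ?_)
    rw [hsplit]
    exact mul_le_mul_left (hUhi π) _
  have hN : (b⁻¹) ^ s.card * (ν C * Q) ≤ ∫⁻ π in C, ∏ u ∈ range t, g u (π (pt u)) ∂ν := by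
    rw [← hind, ← lintegral_const_mul _ hWm]
    refine lintegral_mono (fun π => ?_)
    rw [hsplit]
    exact mul_le_mul_left (hUlo π) _
  calc (b ^ s.card)⁻¹ * ((b⁻¹) ^ s.card * ν C)
      = (b ^ s.card)⁻¹ * ((b⁻¹) ^ s.card * ν C) * (Q⁻¹ * Q) := by
        rw [ENNReal.inv_mul_cancel hQ0 hQt, mul_one]
    _ = ((b ^ s.card)⁻¹ * Q⁻¹) * ((b⁻¹) ^ s.card * (ν C * Q)) := by ring
    _ = (b ^ s.card * Q)⁻¹ * ((b⁻¹) ^ s.card * (ν C * Q)) := by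
        rw [ENNReal.mul_inv (Or.inr hQt) (Or.inr hQ0)]
    _ ≤ _ := mul_le_mul' (ENNReal.inv_le_inv.2 hD) hN

/-- On `[0,1]`, `toSimplex2` agrees with a continuous map. -/
lemma toSimplex2_cont : ∃ h : ℝ → ↥(cS 2), Continuous h ∧
    ∀ x ∈ Set.Icc (0 : ℝ) 1, toSimplex2 x = h x := by
  refine ⟨fun x => ⟨![max 0 (min x 1), 1 - max 0 (min x 1)], ?_, ?_⟩, ?_, ?_⟩
  · intro i
    fin_cases i <;> simp
  · simp [Fin.sum_univ_two]
  · refine Continuous.subtype_mk (continuous_pi fun i => ?_) _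
    fin_cases i
    · simp only [Fin.zero_eta, Matrix.cons_val_zero]; fun_prop
    · simp only [Fin.mk_one, Matrix.cons_val_one, Matrix.cons_val_fin_one]; fun_prop
  · intro x hx
    rw [toSimplex2, dif_pos hx]
    apply Subtype.ext
    funext i
    fin_cases i <;> simp [hx.1, hx.2]

lemma measurable_toSimplex2 : Measurable toSimplex2 := by
  obtain ⟨h, hc, he⟩ := toSimplex2_cont
  have : toSimplex2 = (Set.Icc (0 : ℝ) 1).piecewise h (fun _ => toSimplex2 2) := by
    funext x
    by_cases hx : x ∈ Set.Icc (0 : ℝ) 1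
    · rw [Set.piecewise_eq_of_mem _ _ _ hx, he x hx]
    · rw [Set.piecewise_eq_of_notMem _ _ _ hx, toSimplex2, dif_neg hx, toSimplex2,
        dif_neg (by norm_num)]
  rw [this]
  exact hc.measurable.piecewise measurableSet_Icc measurable_const

lemma unif2_pos (B : Set ↥(cS 2)) (hB : IsOpen B) (hne : B.Nonempty) : unif2 B ≠ 0 := by
  obtain ⟨w, hw⟩ := hne
  obtain ⟨h, hc, he⟩ := toSimplex2_cont
  rw [unif2, Measure.map_apply measurable_toSimplex2 hB.measurableSet,
    Measure.restrict_apply (measurable_toSimplex2 hB.measurableSet)]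
  have hO : IsOpen (h ⁻¹' B) := hB.preimage hc
  have hs := w.2.2
  rw [Fin.sum_univ_two] at hs
  have hx : (w : Fin 2 → ℝ) 0 ∈ Set.Icc (0 : ℝ) 1 :=
    ⟨w.2.1 0, by linarith [w.2.1 1]⟩
  have hxw : h ((w : Fin 2 → ℝ) 0) = w := by
    rw [← he _ hx, toSimplex2, dif_pos hx]
    apply Subtype.ext
    funext i
    fin_cases i
    · simp
    · simp only [Fin.mk_one, one_ne_zero, if_false]
      linarith
  have hxc : (w : Fin 2 → ℝ) 0 ∈ closure (Set.Ioo (0 : ℝ) 1) := by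
    rw [closure_Ioo (by norm_num)]; exact hx
  have hn : (h ⁻¹' B ∩ Set.Ioo (0 : ℝ) 1).Nonempty :=
    mem_closure_iff.1 hxc _ hO (by simpa [hxw] using hw)
  have hp := (hO.inter isOpen_Ioo).measure_pos volume hn
  refine (lt_of_lt_of_le hp (measure_mono ?_)).ne'
  rintro x ⟨hxB, hxI⟩
  have hxI' := Set.Ioo_subset_Icc_self hxI
  refine ⟨?_, hxI'⟩
  simp only [Set.mem_preimage] at hxB ⊢
  rw [he x hxI']; exact hxB

lemma wd_le_one {T : Type*} [MeasurableSpace T] (ν0 : Measure T) (V : T → ℝ) (F : Set T) :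
    wd ν0 V F ≤ 1 := by
  refine (measure_mono (Set.subset_univ F)).trans ?_
  simp only [wd, Measure.smul_apply, smul_eq_mul]
  exact ENNReal.inv_mul_le_one _

/-- Proposition 3.9: along the market path of Proposition 3.8, the wealth
distributions on `Θ = (Δ̄₂)^E` satisfy the LDP with the trivial rate function `I ≡ 0`. -/
theorem stmt12 (δ : ℚ) (hδ : 0 < δ)
    (μ : ℕ → ↥(oS 2)) (hr : ∀ t, μ t ∈ Eq2)
    (hμ0 : (μ 0 : Fin 2 → ℝ) 0 = 1 / 2 ∧ (μ 0 : Fin 2 → ℝ) 1 = 1 / 2)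
    (hrec : ∀ t,
      (μ (t + 1) : Fin 2 → ℝ) 0 =
        (μ t : Fin 2 → ℝ) 0 / (1 + (δ : ℝ) * (μ t : Fin 2 → ℝ) 1) ∧
      (μ (t + 1) : Fin 2 → ℝ) 1 =
        (1 + (δ : ℝ)) * (μ t : Fin 2 → ℝ) 1 / (1 + (δ : ℝ) * (μ t : Fin 2 → ℝ) 1))
    (ν0 : Measure (↥Eq2 → ↥(cS 2))) [IsProbabilityMeasure ν0]
    (hprod : ∀ (s : Finset ↥Eq2) (B : ↥Eq2 → Set ↥(cS 2)),
      (∀ p, MeasurableSet (B p)) →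
      ν0 {π : ↥Eq2 → ↥(cS 2) | ∀ p ∈ s, π p ∈ B p} = ∏ p ∈ s, unif2 (B p)) :
    (∀ F : Set (↥Eq2 → ↥(cS 2)), IsClosed F →
      limsup (fun t : ℕ =>
          (((t : ℝ)⁻¹ : ℝ) : EReal) *
            ENNReal.log (wd ν0 (fun π => pVQ μ hr π t) F)) atTop
        ≤ -(⨅ π ∈ F, ((0 : ℝ) : EReal))) ∧
    (∀ G : Set (↥Eq2 → ↥(cS 2)), IsOpen G →
      -(⨅ π ∈ G, ((0 : ℝ) : EReal)) ≤
        liminf (fun t : ℕ =>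
          (((t : ℝ)⁻¹ : ℝ) : EReal) *
            ENNReal.log (wd ν0 (fun π => pVQ μ hr π t) G)) atTop) := by
  have hnonpos : ∀ F : Set (↥Eq2 → ↥(cS 2)), ∀ t : ℕ,
      (((t : ℝ)⁻¹ : ℝ) : EReal) * ENNReal.log (wd ν0 (fun π => pVQ μ hr π t) F) ≤ 0 := by
    intro F t
    refine mul_nonpos_of_nonneg_of_nonpos ?_ (ENNReal.log_le_zero_iff.2 (wd_le_one _ _ _))
    exact_mod_cast inv_nonneg.2 (Nat.cast_nonneg t)
  have hinf : ∀ F : Set (↥Eq2 → ↥(cS 2)), F.Nonempty →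
      (⨅ π ∈ F, ((0 : ℝ) : EReal)) = 0 := by
    intro F hF
    rw [biInf_const hF]; rfl
  refine ⟨fun F _ => ?_, fun G hG => ?_⟩
  · rcases F.eq_empty_or_nonempty with rfl | hF
    · simp only [measure_empty, ENNReal.log_zero, Set.mem_empty_iff_false, iInf_false, iInf_top,
        EReal.neg_top]
      refine limsup_le_of_le (by isBoundedDefault) ?_
      filter_upwards [eventually_gt_atTop 0] with t ht
      rw [EReal.coe_mul_bot_of_pos (by positivity)]
    · rw [hinf F hF, neg_zero]
      exact limsup_le_of_le (by isBoundedDefault) (Eventually.of_forall (hnonpos F))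
  · rcases G.eq_empty_or_nonempty with rfl | hGn
    · simp
    rw [hinf G hGn, neg_zero]
    obtain ⟨π0, hπ0⟩ := hGn
    obtain ⟨s, B, hsB, hsub⟩ := isOpen_pi_iff.1 hG π0 hπ0
    have hpr : IsProbabilityMeasure unif2 := by
      constructor
      rw [unif2, Measure.map_apply measurable_toSimplex2 MeasurableSet.univ]
      simp
    have hν : ν0 = Measure.infinitePi (fun _ : ↥Eq2 => unif2) :=
      Measure.eq_infinitePi _ (fun s t ht => hprod s t ht)
    have hpos : ν0 (Set.pi s B) ≠ 0 := by
      rw [hν, Measure.infinitePi_pi _ (fun i hi => (hsB i hi).1.measurableSet)]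
      exact Finset.prod_ne_zero_iff.2
        (fun p hp => unif2_pos _ (hsB p hp).1 ⟨_, (hsB p hp).2⟩)
    have hδ' : (0 : ℝ) < δ := by exact_mod_cast hδ
    have hp0 : ∀ t, 0 < (μ t : Fin 2 → ℝ) 0 := fun t => (μ t).2.1 0
    have hp1 : ∀ t, 0 < (μ t : Fin 2 → ℝ) 1 := fun t => (μ t).2.1 1
    have hsum : ∀ t, (μ t : Fin 2 → ℝ) 0 + (μ t : Fin 2 → ℝ) 1 = 1 := fun t => by
      simpa [Fin.sum_univ_two] using (μ t).2.2
    have hden : ∀ t, 1 < 1 + (δ : ℝ) * (μ t : Fin 2 → ℝ) 1 := fun t => by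
      have := mul_pos hδ' (hp1 t); linarith
    have hanti : StrictAnti (fun t => (μ t : Fin 2 → ℝ) 0) := by
      refine strictAnti_nat_of_succ_lt (fun t => ?_)
      rw [(hrec t).1]
      exact div_lt_self (hp0 t) (hden t)
    let pt : ℕ → ↥Eq2 := fun t => ⟨μ t, hr t⟩
    have hpt : Function.Injective pt := by
      intro t u h
      apply hanti.injective
      have : μ t = μ u := congrArg Subtype.val h
      simp [this]
    let gr : ℕ → ↥(cS 2) → ℝ := fun t w =>
      ∑ i, (w : Fin 2 → ℝ) i * ((μ (t + 1) : Fin 2 → ℝ) i / (μ t : Fin 2 → ℝ) i)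
    have hgr : ∀ t w, gr t w = (1 + δ * (w : Fin 2 → ℝ) 1) / (1 + δ * (μ t : Fin 2 → ℝ) 1) := by
      intro t w
      have hw : (w : Fin 2 → ℝ) 0 = 1 - (w : Fin 2 → ℝ) 1 := by
        have := w.2.2
        rw [Fin.sum_univ_two] at this
        linarith
      have h0 := (hp0 t).ne'
      have h1 := (hp1 t).ne'
      have h2 : 1 + (δ : ℝ) * (μ t : Fin 2 → ℝ) 1 ≠ 0 := by linarith [hden t]
      simp only [gr, Fin.sum_univ_two]
      rw [(hrec t).1, (hrec t).2, hw]
      field_simp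
      ring
    have hw01 : ∀ w : ↥(cS 2), 0 ≤ (w : Fin 2 → ℝ) 1 ∧ (w : Fin 2 → ℝ) 1 ≤ 1 := by
      intro w
      have := w.2.2
      rw [Fin.sum_univ_two] at this
      exact ⟨w.2.1 1, by linarith [w.2.1 0]⟩
    have hhi : ∀ t w, gr t w ≤ 1 + δ := by
      intro t w
      rw [hgr, div_le_iff₀ (by linarith [hden t])]
      nlinarith [hw01 w, hden t]
    have hlo : ∀ t w, (1 + (δ : ℝ))⁻¹ ≤ gr t w := by
      intro t w
      rw [hgr, inv_eq_one_div]
      apply div_le_div₀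
      · nlinarith [(hw01 w).1]
      · nlinarith [(hw01 w).1]
      · linarith [hden t]
      · nlinarith [hp0 t, hsum t]
    have hgr0 : ∀ t w, 0 ≤ gr t w := fun t w => (by positivity : (0:ℝ) ≤ (1 + (δ : ℝ))⁻¹).trans (hlo t w)
    have hV : ∀ π t, pVQ μ hr π t = ∏ u ∈ range t, gr u (π (pt u)) := by
      intro π t
      induction t with
      | zero => simp [pVQ, relV]
      | succ t ih => rw [Finset.prod_range_succ, ← ih]; rfl
    have hVE : ∀ t, (fun π => ENNReal.ofReal (pVQ μ hr π t)) =
        fun π => ∏ u ∈ range t, ENNReal.ofReal (gr u (π (pt u))) := by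
      intro t
      ext π
      rw [hV, ENNReal.ofReal_prod_of_nonneg (fun u _ => hgr0 u _)]
    set b : ℝ≥0∞ := ENNReal.ofReal (1 + δ) with hb
    have hgm : ∀ u, Measurable (fun w => ENNReal.ofReal (gr u w)) := by
      intro u
      apply ENNReal.measurable_ofReal.comp
      apply Finset.measurable_sum
      intro i _
      exact ((measurable_pi_apply i).comp measurable_subtype_coe).mul_const _
    have hb1 : 1 ≤ b := by
      rw [hb, ENNReal.one_le_ofReal]; linarith
    have hkey := key_bound unif2 ν0 hν s B (fun i hi => (hsB i hi).1.measurableSet) pt hpt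
      (fun u w => ENNReal.ofReal (gr u w)) hgm b hb1 ENNReal.ofReal_ne_top
      (fun u w => by
        rw [hb, ← ENNReal.ofReal_inv_of_pos (by linarith)]
        exact ENNReal.ofReal_le_ofReal (hlo u w))
      (fun u w => ENNReal.ofReal_le_ofReal (hhi u w))
    set c : ℝ≥0∞ := (b ^ s.card)⁻¹ * ((b⁻¹) ^ s.card * ν0 (Set.pi s B)) with hc
    have hb0 : b ≠ 0 := (lt_of_lt_of_le one_pos hb1).ne'
    have hbt : b ≠ ⊤ := ENNReal.ofReal_ne_top
    have hc0 : c ≠ 0 :=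
      mul_ne_zero (ENNReal.inv_ne_zero.2 (ENNReal.pow_ne_top hbt))
        (mul_ne_zero (pow_ne_zero _ (ENNReal.inv_ne_zero.2 hbt)) hpos)
    have hwd : ∀ t, c ≤ wd ν0 (fun π => pVQ μ hr π t) G := by
      intro t
      refine le_trans ?_ (measure_mono hsub)
      simp only [wd, Measure.smul_apply, smul_eq_mul]
      rw [withDensity_apply _ MeasurableSet.univ, withDensity_apply _
        (MeasurableSet.pi s.countable_toSet (fun i hi => (hsB i hi).1.measurableSet)),
        Measure.restrict_univ, hVE]
      exact hkey t
    have hct : c ≠ ⊤ :=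
      ne_top_of_le_ne_top ENNReal.one_ne_top ((hwd 0).trans (wd_le_one _ _ _))
    have hlim : Tendsto (fun t : ℕ => (((t : ℝ)⁻¹ : ℝ) : EReal) * ENNReal.log c) atTop (𝓝 0) := by
      rw [ENNReal.log_pos_real hc0 hct]
      have h : Tendsto (fun t : ℕ => (t : ℝ)⁻¹ * Real.log c.toReal) atTop (𝓝 0) := by
        simpa using (tendsto_inv_atTop_nhds_zero_nat (𝕜 := ℝ)).mul_const (Real.log c.toReal)
      exact_mod_cast (continuous_coe_real_ereal.tendsto 0).comp h
    rw [← hlim.liminf_eq]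
    refine liminf_le_liminf (Eventually.of_forall (fun t => ?_))
    refine mul_le_mul_of_nonneg_left (ENNReal.log_le_log (hwd t)) ?_
    exact_mod_cast inv_nonneg.2 (Nat.cast_nonneg t)
end
end

section
/- Let Φ: Δ_n → (0,∞) be a positive concave function. For each p ∈ Δ_n let v(p) be a supergradient of log Φ at p (an element of ∂ log Φ(p), satisfying Σ_i v_i(p) = 0), and define π(p) by π_i(p) = p_i ( v_i(p) + 1 − Σ_{j=1}^n p_j v_j(p) ). Then π maps Δ_n into the closed simplex Δ̄_n (each π_i(p) ≥ 0 and Σ_i π_i(p) = 1) and π is a portfolio generated by Φ, i.e., Σ_i π_i(p) q_i/p_i ≥ Φ(q)/Φ(p) for all p, q ∈ Δ_n. -/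
open MeasureTheory Filter Topology Finset

noncomputable section

/-- The superdifferential of `Ψ : Δₙ → ℝ` at `p`: vectors `ξ` tangent to the simplex
(`Σ_i ξ_i = 0`) with `Ψ(p) + ⟨ξ, q − p⟩ ≥ Ψ(q)` for all `q ∈ Δₙ`. -/
def superdiff {n : ℕ} (Ψ : ↥(oS n) → ℝ) (p : ↥(oS n)) : Set (Fin n → ℝ) :=
  {ξ | (∑ i, ξ i = 0) ∧ ∀ q : ↥(oS n),
    Ψ q ≤ Ψ p + ∑ i, ξ i * ((q : Fin n → ℝ) i - (p : Fin n → ℝ) i)}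

lemma aux_lim (a s : ℝ) (h : ∀ t : ℝ, 0 < t → t < 1 → 1 + t * (a - 1) ≤ Real.exp (t * s)) :
    a ≤ 1 + s := by
  by_contra hcon
  push Not at hcon
  set d := a - 1 - s with hd
  have hd0 : 0 < d := by linarith
  set K := 1 + |s| + |s * (a - 1)| with hK
  have h1 := abs_nonneg s
  have h2 := abs_nonneg (s * (a - 1))
  have hK0 : 0 < K := by linarith
  set t := d / ((1 + d) * K) with ht
  have ht0 : 0 < t := by positivity
  have htK : t * K = d / (1 + d) := by rw [ht]; field_simp
  have hq1 : d / (1 + d) < 1 := by rw [div_lt_one (by linarith)]; linarith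
  have hq2 : d / (1 + d) < d := by rw [div_lt_iff₀ (by linarith)]; nlinarith
  have ht1 : t < 1 := by nlinarith
  have hts : t * s < 1 := by
    have := mul_le_mul_of_nonneg_left (show s ≤ K by linarith [le_abs_self s]) ht0.le
    linarith
  have hts2 : t * (s * (a - 1)) < d := by
    have := mul_le_mul_of_nonneg_left
      (show s * (a - 1) ≤ K by linarith [le_abs_self (s * (a - 1))]) ht0.le
    linarith
  have h3 := h t ht0 ht1
  have h4 := Real.add_one_le_exp (-(t * s))
  have h5 : Real.exp (t * s) * Real.exp (-(t * s)) = 1 := by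
    rw [← Real.exp_add]; simp
  have h6 : Real.exp (t * s) * (1 - t * s) ≤ 1 := by
    rw [← h5]
    exact mul_le_mul_of_nonneg_left (by linarith) (Real.exp_pos _).le
  have h7 : (1 + t * (a - 1)) * (1 - t * s) ≤ 1 :=
    le_trans (mul_le_mul_of_nonneg_right h3 (by linarith)) h6
  have h8 : t * (d - t * (s * (a - 1))) ≤ 0 := by
    rw [hd]; linarith
  have h9 : 0 < t * (d - t * (s * (a - 1))) := mul_pos ht0 (by linarith)
  linarith

/-- Lemma 4.1(ii): a measurable selection of supergradients of `log Φ`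
yields a portfolio generated by `Φ`. -/
theorem stmt14 {n : ℕ} (hn : 2 ≤ n)
    (Φ : (Fin n → ℝ) → ℝ)
    (hpos : ∀ p ∈ oS n, 0 < Φ p) (hconc : ConcaveOn ℝ (oS n) Φ)
    (v : ↥(oS n) → Fin n → ℝ)
    (hv : ∀ p : ↥(oS n), v p ∈ superdiff (fun q : ↥(oS n) => Real.log (Φ (q : Fin n → ℝ))) p)
    (π : ↥(oS n) → Fin n → ℝ)
    (hπ : ∀ (p : ↥(oS n)) (i : Fin n),
      π p i = (p : Fin n → ℝ) i * (v p i + 1 - ∑ j, (p : Fin n → ℝ) j * v p j)) :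
    (∀ p : ↥(oS n), π p ∈ cS n) ∧
    ∀ p q : ↥(oS n),
      Φ (q : Fin n → ℝ) / Φ (p : Fin n → ℝ) ≤
        ∑ i, π p i * ((q : Fin n → ℝ) i / (p : Fin n → ℝ) i) := by
  have hseg : ∀ (p q : Fin n → ℝ), p ∈ oS n → (∀ i, 0 ≤ q i) → ∑ i, q i = 1 →
      ∀ t : ℝ, 0 < t → t < 1 → ((1 - t) • p + t • q) ∈ oS n := by
    intro p q hp hq hq1 t ht0 ht1
    refine ⟨fun i => ?_, ?_⟩
    · have h1 := mul_pos (sub_pos.2 ht1) (hp.1 i)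
      have h2 := mul_nonneg ht0.le (hq i)
      simp only [Pi.add_apply, Pi.smul_apply, smul_eq_mul]
      linarith
    · simp only [Pi.add_apply, Pi.smul_apply, smul_eq_mul]
      rw [Finset.sum_add_distrib, ← Finset.mul_sum, ← Finset.mul_sum, hp.2, hq1]
      ring
  have key : ∀ p q : ↥(oS n), Φ (q : Fin n → ℝ) / Φ (p : Fin n → ℝ) ≤
      1 + ∑ i, v p i * ((q : Fin n → ℝ) i - (p : Fin n → ℝ) i) := by
    intro p q
    apply aux_lim
    intro t ht0 ht1
    have hr := hseg p q p.2 (fun i => (q.2.1 i).le) q.2.2 t ht0 ht1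
    have h1 := (hv p).2 ⟨_, hr⟩
    have h2 := hconc.2 p.2 q.2 (sub_pos.2 ht1).le ht0.le (by ring)
    simp only [smul_eq_mul] at h2
    have hp0 := hpos p p.2
    have hr0 := hpos _ hr
    have h3 : ∑ i, v p i * (((1 - t) • (p : Fin n → ℝ) + t • (q : Fin n → ℝ)) i
        - (p : Fin n → ℝ) i) =
        t * ∑ i, v p i * ((q : Fin n → ℝ) i - (p : Fin n → ℝ) i) := by
      rw [Finset.mul_sum]
      refine Finset.sum_congr rfl fun i _ => ?_
      simp only [Pi.add_apply, Pi.smul_apply, smul_eq_mul]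
      ring
    simp only [] at h1
    rw [h3] at h1
    have h4 := Real.exp_le_exp.2 h1
    rw [Real.exp_add, Real.exp_log hr0, Real.exp_log hp0] at h4
    have h5 := h2.trans h4
    rw [← mul_le_mul_iff_right₀ hp0]
    refine le_trans (le_of_eq ?_) h5
    field_simp
    ring
  have expand : ∀ (p : ↥(oS n)) (q : Fin n → ℝ),
      ∑ i, v p i * (q i - (p : Fin n → ℝ) i) =
        ∑ i, v p i * q i - ∑ i, (p : Fin n → ℝ) i * v p i := by
    intro p q
    rw [← Finset.sum_sub_distrib]
    exact Finset.sum_congr rfl fun i _ => by ring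
  refine ⟨fun p => ⟨fun i => ?_, ?_⟩, fun p q => ?_⟩
  · rw [hπ]
    refine mul_nonneg (p.2.1 i).le ?_
    by_contra hneg
    push Not at hneg
    set m := ∑ j, (p : Fin n → ℝ) j * v p j with hm
    set c := m - v p i with hc
    have hc1 : 1 < c := by linarith
    have hc0 : 0 < c := by linarith
    have hr := hseg p (Pi.single i 1) p.2
      (fun j => by by_cases h : j = i
                   · subst h; simp
                   · simp [h])
      (by simp) (1 / c) (by positivity) (by rw [div_lt_one hc0]; exact hc1)
    have h1 := key p ⟨_, hr⟩
    have h2 : 0 < Φ ((1 - 1 / c) • (p : Fin n → ℝ) + (1 / c) • (Pi.single i 1 : Fin n → ℝ)) /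
      Φ (p : Fin n → ℝ) := div_pos (hpos _ hr) (hpos _ p.2)
    have h3 := h2.trans_le h1
    simp only [] at h3
    rw [expand] at h3
    have h4 : ∑ j, v p j * ((1 - 1 / c) • (p : Fin n → ℝ)
        + (1 / c) • (Pi.single i 1 : Fin n → ℝ)) j = (1 - 1 / c) * m + 1 / c * v p i := by
      have e : ∀ j, v p j * ((1 - 1 / c) • (p : Fin n → ℝ)
        + (1 / c) • (Pi.single i 1 : Fin n → ℝ)) j =
        (1 - 1 / c) * ((p : Fin n → ℝ) j * v p j)
          + 1 / c * (v p j * (Pi.single i 1 : Fin n → ℝ) j) := by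
        intro j
        simp only [Pi.add_apply, Pi.smul_apply, smul_eq_mul]
        ring
      simp only [e]
      rw [Finset.sum_add_distrib, ← Finset.mul_sum, ← Finset.mul_sum]
      simp [Pi.single_apply, hm]
    rw [h4, ← hm] at h3
    have h5 : 1 / c * c = 1 := by field_simp
    have h6 : 1 / c * c = 1 / c * m - 1 / c * v p i := by rw [hc, mul_sub]
    linarith
  · simp only [hπ]
    have e : ∀ i, (p : Fin n → ℝ) i * (v p i + 1 - ∑ j, (p : Fin n → ℝ) j * v p j) =
      (p : Fin n → ℝ) i * v p i
        + (p : Fin n → ℝ) i * (1 - ∑ j, (p : Fin n → ℝ) j * v p j) := fun i => by ring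
    simp only [e]
    rw [Finset.sum_add_distrib, ← Finset.sum_mul, p.2.2]
    ring
  · refine (key p q).trans (le_of_eq ?_)
    rw [expand]
    have e : ∀ i, π p i * ((q : Fin n → ℝ) i / (p : Fin n → ℝ) i) =
      v p i * (q : Fin n → ℝ) i
        + (q : Fin n → ℝ) i * (1 - ∑ j, (p : Fin n → ℝ) j * v p j) := by
      intro i
      have := (p.2.1 i).ne'
      rw [hπ]
      field_simp
      ring
    simp only [e]
    rw [Finset.sum_add_distrib, ← Finset.sum_mul, q.2.2]
    ring
end
end
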